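/- Let μ be a finite complex Borel measure with compact support K contained in the open unit ball B^d, and define g(z) = (1/2)∫_K (1+⟨z,w⟩)/(1-⟨z,w⟩) d\bar μ(w). Then g is holomorphic in a neighborhood of the closed unit ball, and for every holomorphic f on B^d one has ∫_K f dμ = Q(f,g), where Q(f,g) = ∑_α c_α \overline{d_α} α!/|α|! + f(0)\overline{g(0)} with c_α, d_α the Taylor coefficients of f, g. -/

import Mathlib

open MeasureTheory
open scoped Nat

noncomputable instance (d : ℕ) : MeasurableSpace (EuclideanSpace ℂ (Fin d)) := borel _
instance (d : ℕ) : BorelSpace (EuclideanSpace ℂ (Fin d)) := ⟨rfl⟩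

open Filter Topology

lemma fiber_aux {𝕜 : Type*} [RCLike 𝕜] {d : ℕ} (x : Fin d → 𝕜) (n : ℕ) :
    HasSum (fun a : {a // a ∈ Finset.piAntidiag (Finset.univ : Finset (Fin d)) n} =>
      (Nat.multinomial Finset.univ a.1 : 𝕜) * ∏ j, x j ^ a.1 j) ((∑ j, x j) ^ n) := by
  rw [Finset.sum_pow_eq_sum_piAntidiag]
  exact (Finset.piAntidiag (Finset.univ : Finset (Fin d)) n).hasSum
    (fun a => (Nat.multinomial Finset.univ a : 𝕜) * ∏ j, x j ^ a j)

lemma mem_pi_iff {d : ℕ} (n : ℕ) (a : Fin d → ℕ) :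
    ∑ j, a j = n ↔ a ∈ Finset.piAntidiag (Finset.univ : Finset (Fin d)) n := by
  simp [Finset.mem_piAntidiag]

lemma hs_multinomial_fiber {𝕜 : Type*} [RCLike 𝕜] {d : ℕ} (x : Fin d → 𝕜) (n : ℕ) :
    HasSum (fun a : {a : Fin d → ℕ // ∑ j, a j = n} =>
      (Nat.multinomial Finset.univ a.1 : 𝕜) * ∏ j, x j ^ a.1 j) ((∑ j, x j) ^ n) := by
  have h := fiber_aux x n
  generalize (∑ j, x j) ^ n = S at h ⊢
  exact ((Equiv.subtypeEquivRight (mem_pi_iff n)).hasSum_iff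
    (f := fun a : {a // a ∈ Finset.piAntidiag (Finset.univ : Finset (Fin d)) n} =>
      (Nat.multinomial Finset.univ a.1 : 𝕜) * ∏ j, x j ^ a.1 j)).2 h

lemma summable_multinomial {d : ℕ} (y : Fin d → ℝ) (hy : ∀ j, 0 ≤ y j) (h1 : ∑ j, y j < 1) :
    Summable (fun a : Fin d → ℕ => (Nat.multinomial Finset.univ a : ℝ) * ∏ j, y j ^ a j) := by
  rw [← (Equiv.sigmaFiberEquiv (fun a : Fin d → ℕ => ∑ j, a j)).summable_iff]
  refine (summable_sigma_of_nonneg ?_).2 ⟨fun n => ?_, ?_⟩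
  · rintro ⟨n, a⟩
    exact mul_nonneg (Nat.cast_nonneg _) (Finset.prod_nonneg fun j _ => pow_nonneg (hy j) _)
  · exact (hs_multinomial_fiber y n).summable
  · have : (fun n => (∑ j, y j) ^ n) = fun n : ℕ => ∑' a : {a : Fin d → ℕ // ∑ j, a j = n},
      (Nat.multinomial Finset.univ a.1 : ℝ) * ∏ j, y j ^ a.1 j :=
      funext fun n => (hs_multinomial_fiber y n).tsum_eq.symm
    have h2 := summable_geometric_of_lt_one (Finset.sum_nonneg fun j _ => hy j) h1
    rw [this] at h2
    exact h2

lemma hs_multinomial {𝕜 : Type*} [RCLike 𝕜] {d : ℕ} (x : Fin d → 𝕜) (h1 : ∑ j, ‖x j‖ < 1) :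
    HasSum (fun a : Fin d → ℕ => (Nat.multinomial Finset.univ a : 𝕜) * ∏ j, x j ^ a j)
      (1 - ∑ j, x j)⁻¹ := by
  have hsum : Summable (fun a : Fin d → ℕ =>
      (Nat.multinomial Finset.univ a : 𝕜) * ∏ j, x j ^ a j) := by
    refine Summable.of_norm ?_
    convert summable_multinomial (fun j => ‖x j‖) (fun j => norm_nonneg _) h1 using 2 with a
    simp [norm_prod]
  rw [← (Equiv.sigmaFiberEquiv (fun a : Fin d → ℕ => ∑ j, a j)).hasSum_iff]
  refine HasSum.sigma_of_hasSum (g := fun n => (∑ j, x j) ^ n) ?_ (fun n => ?_) ?_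
  · exact hasSum_geometric_of_norm_lt_one ((norm_sum_le _ _).trans_lt h1)
  · exact hs_multinomial_fiber x n
  · exact (Equiv.summable_iff _).2 hsum

lemma interchange {X ι : Type*} [MeasurableSpace X] [Countable ι] (ν : Measure X)
    [IsFiniteMeasure ν] (F : ι → X → ℂ) (hF : ∀ i, Measurable (F i)) (C : ℝ)
    (hC : ∀ᵐ w ∂ν, ∀ T : Finset ι, ∑ i ∈ T, ‖F i w‖ ≤ C) :
    HasSum (fun i => ∫ w, F i w ∂ν) (∫ w, ∑' i, F i w ∂ν) := by
  have hint : ∀ i, Integrable (F i) ν := fun i =>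
    Integrable.of_bound (hF i).aestronglyMeasurable C (hC.mono fun w hw => by simpa using hw {i})
  refine hasSum_integral_of_summable_integral_norm hint ?_
  refine summable_of_sum_le (c := ∫ w, C ∂ν) (fun i => integral_nonneg fun w => norm_nonneg _) ?_
  intro T
  rw [← integral_finsetSum _ fun i _ => (hint i).norm]
  refine integral_mono_ae (integrable_finsetSum _ fun i _ => (hint i).norm) (integrable_const _) ?_
  exact hC.mono fun w hw => hw T

lemma coeff_unique {d : ℕ} (a : (Fin d → ℕ) → ℂ)
    (h : ∀ z : EuclideanSpace ℂ (Fin d), ‖z‖ < 1 →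
      HasSum (fun α : Fin d → ℕ => a α * ∏ j, z j ^ α j) 0) : a = 0 := by
  set ρ : ℝ := 1 / (d + 1) with hρ
  have hρ0 : 0 < ρ := by positivity
  let Z : UnitAddTorus (Fin d) → EuclideanSpace ℂ (Fin d) := fun t =>
    WithLp.toLp 2 fun j => (ρ : ℂ) * fourier 1 (t j)
  have hZ : ∀ t, ‖Z t‖ < 1 := by
    intro t
    have h1 : ‖Z t‖ ^ 2 = d * ρ ^ 2 := by
      rw [EuclideanSpace.norm_sq_eq]
      simp [Z, fourier_apply, Circle.norm_coe]
    have h2 : (d : ℝ) * ρ ^ 2 < 1 := by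
      rw [hρ, div_pow, one_pow, mul_one_div, div_lt_one (by positivity)]
      nlinarith [Nat.cast_nonneg (α := ℝ) d]
    nlinarith [norm_nonneg (Z t)]
  let m : (Fin d → ℕ) → Fin d → ℤ := fun α j => (α j : ℤ)
  have hm : Function.Injective m := fun α β hab => funext fun j => by
    have := congrFun hab j
    simpa [m] using this
  let b : (Fin d → ℕ) → ℂ := fun α => a α * (ρ : ℂ) ^ (∑ j, α j)
  have hterm : ∀ t α, a α * ∏ j, (Z t) j ^ α j = b α * UnitAddTorus.mFourier (m α) t := by
    intro t α
    simp only [Z, b, UnitAddTorus.mFourier, m, ContinuousMap.coe_mk, mul_pow,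
      Finset.prod_mul_distrib, Finset.prod_pow_eq_pow_sum, mul_assoc]
    congr 2
    refine Finset.prod_congr rfl fun j _ => ?_
    simp [fourier_apply, AddCircle.toCircle_nsmul]
  have hbs : Summable fun α => ‖b α‖ := by
    have := (h (Z 0) (hZ 0)).summable.norm
    simp only [hterm] at this
    simpa [UnitAddTorus.mFourier] using this
  have hS : Summable fun α => b α • UnitAddTorus.mFourier (m α) := by
    refine Summable.of_norm ?_
    simpa [norm_smul, UnitAddTorus.mFourier_norm] using hbs
  have hS0 : HasSum (fun α => b α • UnitAddTorus.mFourier (m α)) 0 := by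
    have : ∑' α, b α • UnitAddTorus.mFourier (m α) = 0 := by
      ext t
      have h1 := (ContinuousMap.evalCLM ℂ t).hasSum hS.hasSum
      have h2 := h (Z t) (hZ t)
      simp only [hterm] at h2
      exact h1.unique h2
    rw [← this]; exact hS.hasSum
  funext β
  let _ : MeasureSpace UnitAddCircle := instMeasureSpaceUnitAddCircle
  have : IsProbabilityMeasure (volume : Measure UnitAddCircle) :=
    inferInstanceAs (IsProbabilityMeasure AddCircle.haarAddCircle)
  have hI := ((innerSL ℂ (UnitAddTorus.mFourierLp 2 (m β))).comp
    (ContinuousMap.toLp (E := ℂ) 2 volume ℂ)).hasSum hS0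
  rw [map_zero] at hI
  have e : (fun α => if α = β then b β else 0) = fun α =>
      ((innerSL ℂ (UnitAddTorus.mFourierLp 2 (m β))).comp
        (ContinuousMap.toLp (E := ℂ) 2 volume ℂ)) (b α • UnitAddTorus.mFourier (m α)) := by
    funext α
    have ho := (orthonormal_iff_ite.1 UnitAddTorus.orthonormal_mFourier) (m β) (m α)
    rw [map_smul]
    change _ = b α * inner ℂ (UnitAddTorus.mFourierLp 2 (m β)) (UnitAddTorus.mFourierLp 2 (m α))
    rw [ho]
    by_cases hab : α = β
    · simp [hab]
    · rw [if_neg hab, if_neg fun h => hab (hm h).symm, mul_zero]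
  have hI2 : HasSum (fun α => if α = β then b β else 0) (0:ℂ) := by
    rw [e]; exact hI
  have := hI2.unique (hasSum_ite_eq β (b β))
  have hb : a β * (ρ : ℂ) ^ (∑ j, β j) = 0 := this.symm
  simpa [hρ0.ne'] using hb

lemma cs {d : ℕ} (z w : EuclideanSpace ℂ (Fin d)) : ∑ j, ‖z j * star (w j)‖ ≤ ‖z‖ * ‖w‖ := by
  have := Real.sum_mul_le_sqrt_mul_sqrt Finset.univ (fun j => ‖z j‖) (fun j => ‖w j‖)
  simpa [EuclideanSpace.norm_eq] using this

lemma compact_bound {d : ℕ} (c : (Fin d → ℕ) → ℂ)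
    (h : ∀ z : EuclideanSpace ℂ (Fin d), ‖z‖ < 1 →
      Summable (fun α : Fin d → ℕ => c α * ∏ j, z j ^ α j)) (r : ℝ) (hr : r < 1) :
    ∃ C : ℝ, ∀ w ∈ Metric.closedBall (0 : EuclideanSpace ℂ (Fin d)) r,
      ∀ T : Finset (Fin d → ℕ), ∑ α ∈ T, ‖c α * ∏ j, w j ^ α j‖ ≤ C := by
  refine (isCompact_closedBall (0 : EuclideanSpace ℂ (Fin d)) r).induction_on
    (p := fun S => ∃ C : ℝ, ∀ w ∈ S,
      ∀ T : Finset (Fin d → ℕ), ∑ α ∈ T, ‖c α * ∏ j, w j ^ α j‖ ≤ C) ⟨0, by simp⟩ ?_ ?_ ?_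
  · rintro S T hST ⟨C, hC⟩
    exact ⟨C, fun w hw => hC w (hST hw)⟩
  · rintro S T ⟨C, hC⟩ ⟨D, hD⟩
    refine ⟨max C D, fun w hw U => ?_⟩
    rcases hw with hw | hw
    · exact (hC w hw U).trans (le_max_left _ _)
    · exact (hD w hw U).trans (le_max_right _ _)
  · intro w0 hw0
    have hw1 : ‖w0‖ < 1 := (mem_closedBall_zero_iff.1 hw0).trans_lt hr
    let P : ℝ → EuclideanSpace ℂ (Fin d) := fun ε => WithLp.toLp 2 fun j => ((‖w0 j‖ + ε : ℝ) : ℂ)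
    have hP : Continuous fun ε => ‖P ε‖ := by
      simp only [P, EuclideanSpace.norm_eq]
      fun_prop
    have hP0 : ‖P 0‖ = ‖w0‖ := by simp [P, EuclideanSpace.norm_eq]
    have hev : ∀ᶠ ε in 𝓝[>] (0:ℝ), ‖P ε‖ < 1 :=
      (hP.tendsto 0).mono_left nhdsWithin_le_nhds |>.eventually (gt_mem_nhds (by rw [hP0]; exact hw1))
    obtain ⟨ε, hε1, hε0⟩ := (hev.and self_mem_nhdsWithin).exists
    have hε0 : 0 < ε := hε0
    refine ⟨Metric.ball w0 ε, mem_nhdsWithin_of_mem_nhds (Metric.ball_mem_nhds _ hε0),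
      ∑' α, ‖c α * ∏ j, (P ε) j ^ α j‖, fun w hw T => ?_⟩
    have hs := (h (P ε) hε1).norm
    refine le_trans (Finset.sum_le_sum fun α _ => ?_) (hs.sum_le_tsum T fun _ _ => norm_nonneg _)
    simp only [norm_mul, norm_prod, norm_pow]
    gcongr with j
    have h1 : ‖w j - w0 j‖ < ε :=
      lt_of_le_of_lt (PiLp.norm_apply_le (w - w0) j) (by simpa [dist_eq_norm] using hw)
    have h2 : ‖w j‖ ≤ ‖w0 j‖ + ‖w j - w0 j‖ := by
      simpa using norm_add_le (w0 j) (w j - w0 j)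
    have h3 : ‖(P ε) j‖ = ‖w0 j‖ + ε := by
      simp only [P, Complex.norm_real, Real.norm_eq_abs]
      exact abs_of_nonneg (by positivity)
    rw [h3]; linarith

lemma at_zero {d : ℕ} (a : (Fin d → ℕ) → ℂ) (v : ℂ)
    (h : HasSum (fun α : Fin d → ℕ => a α * ∏ j, (0 : EuclideanSpace ℂ (Fin d)) j ^ α j) v) :
    v = a 0 := by
  refine h.unique ?_
  convert hasSum_ite_eq (0 : Fin d → ℕ) (a 0) using 1
  funext α
  by_cases hα : α = 0
  · subst hα; simp
  · obtain ⟨j, hj⟩ := Function.ne_iff.1 hα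
    rw [if_neg hα, Finset.prod_eq_zero (Finset.mem_univ j), mul_zero]
    simpa using hj

lemma part_one (d : ℕ) (ν : Measure (EuclideanSpace ℂ (Fin d))) [IsFiniteMeasure ν]
    (h : EuclideanSpace ℂ (Fin d) → ℂ) (hmeas : Measurable h) (hbd : ∀ w, ‖h w‖ ≤ 1)
    (r : ℝ) (hr0 : 0 ≤ r) (hr : r < 1) (hae : ∀ᵐ w ∂ν, ‖w‖ ≤ r) :
    ∃ t : ℝ, 1 < t ∧ DifferentiableOn ℂ (fun z : EuclideanSpace ℂ (Fin d) =>
      ∫ w, ((1 + inner ℂ w z) / (1 - inner ℂ w z)) * star (h w) ∂ν)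
      (Metric.ball (0 : EuclideanSpace ℂ (Fin d)) t) := by
  set t : ℝ := 2 / (1 + r) with ht
  have ht1 : 1 < t := by rw [ht, lt_div_iff₀ (by linarith)]; linarith
  have hq : t * r < 1 := by
    rw [ht, div_mul_eq_mul_div, div_lt_one (by linarith)]; linarith
  refine ⟨t, ht1, fun z0 hz0 => ?_⟩
  have hx : ∀ z ∈ Metric.ball (0 : EuclideanSpace ℂ (Fin d)) t, ∀ w : EuclideanSpace ℂ (Fin d),
      ‖w‖ ≤ r → ‖inner ℂ w z‖ ≤ t * r := by
    intro z hz w hw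
    have hz' : ‖z‖ ≤ t := (mem_ball_zero_iff.1 hz).le
    calc ‖inner ℂ w z‖ ≤ ‖w‖ * ‖z‖ := norm_inner_le_norm _ _
      _ ≤ r * t := by gcongr
      _ = t * r := mul_comm _ _
  have hlow : ∀ z ∈ Metric.ball (0 : EuclideanSpace ℂ (Fin d)) t, ∀ w : EuclideanSpace ℂ (Fin d),
      ‖w‖ ≤ r → 1 - t * r ≤ ‖1 - inner ℂ w z‖ := by
    intro z hz w hw
    have h1 := norm_sub_norm_le (1 : ℂ) (inner ℂ w z)
    have h2 := hx z hz w hw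
    rw [norm_one] at h1
    linarith
  have hmeasI : ∀ z : EuclideanSpace ℂ (Fin d),
      Measurable fun w : EuclideanSpace ℂ (Fin d) => (inner ℂ w z : ℂ) := fun z =>
    (continuous_id.inner continuous_const).measurable
  have hms : Measurable fun w => star (h w) := continuous_star.measurable.comp hmeas
  have hFm : ∀ z : EuclideanSpace ℂ (Fin d), Measurable fun w =>
      ((1 + inner ℂ w z) / (1 - inner ℂ w z)) * star (h w) := fun z =>
    (((hmeasI z).const_add 1).div ((hmeasI z).const_sub 1)).mul hms
  have hq' : 0 < 1 - t * r := by linarith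
  have key := hasFDerivAt_integral_of_dominated_of_fderiv_le (𝕜 := ℂ) (μ := ν)
    (F := fun z w => ((1 + inner ℂ w z) / (1 - inner ℂ w z)) * star (h w))
    (F' := fun z w => (2 / (1 - inner ℂ w z) ^ 2 * star (h w)) • innerSL ℂ w)
    (bound := fun _ => 2 / (1 - t * r) ^ 2 * 1 * r) (x₀ := z0)
    (s := Metric.ball (0 : EuclideanSpace ℂ (Fin d)) t)
    (Metric.isOpen_ball.mem_nhds hz0)
    (Filter.Eventually.of_forall fun z => (hFm z).aestronglyMeasurable)
    ?_ ?_ ?_ (integrable_const _) ?_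
  · exact key.differentiableAt.differentiableWithinAt
  · refine Integrable.of_bound (hFm z0).aestronglyMeasurable ((1 + t * r) / (1 - t * r) * 1) ?_
    filter_upwards [hae] with w hw
    rw [norm_mul, norm_div, norm_star]
    have h1 := hlow z0 hz0 w hw
    have h2 : ‖1 + inner ℂ w z0‖ ≤ 1 + t * r := by
      refine (norm_add_le _ _).trans ?_
      rw [norm_one]; linarith [hx z0 hz0 w hw]
    have h3 : 0 ≤ 1 + t * r := (norm_nonneg _).trans h2
    gcongr
    exact hbd w
  · have m1 : AEStronglyMeasurable (fun w => 2 / (1 - (inner ℂ w z0 : ℂ)) ^ 2 * star (h w)) ν :=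
      (((((hmeasI z0).const_sub 1).pow_const 2).const_div 2).mul hms).aestronglyMeasurable
    have m2 : AEStronglyMeasurable (fun w : EuclideanSpace ℂ (Fin d) => innerSL ℂ w) ν :=
      (innerSL ℂ (E := EuclideanSpace ℂ (Fin d))).continuous.aestronglyMeasurable
    exact m1.smul m2
  · filter_upwards [hae] with w hw z hz
    rw [norm_smul, innerSL_apply_norm, norm_mul, norm_div, norm_pow, norm_star]
    have h1 := hlow z hz w hw
    have h4 : ‖(2:ℂ)‖ = 2 := by simp
    rw [h4]
    gcongr
    exact hbd w
  · filter_upwards [hae] with w hw z hz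
    have h1 := hlow z hz w hw
    have hne : (1 : ℂ) - inner ℂ w z ≠ 0 := norm_pos_iff.1 (by linarith)
    have hd : HasDerivAt (fun x : ℂ => (1 + x) / (1 - x) * star (h w))
        (2 / (1 - inner ℂ w z) ^ 2 * star (h w)) (inner ℂ w z) := by
      have := ((((hasDerivAt_id (inner ℂ w z : ℂ)).const_add 1).div
        ((hasDerivAt_id (inner ℂ w z : ℂ)).const_sub 1) hne).mul_const (star (h w)))
      have e : 2 / (1 - inner ℂ w z) ^ 2 * star (h w) =
          (1 * (1 - id (inner ℂ w z : ℂ)) - (1 + id (inner ℂ w z : ℂ)) * -1) /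
            (1 - id (inner ℂ w z : ℂ)) ^ 2 * star (h w) := by
        simp only [id]
        ring
      rw [e]
      exact this
    exact hd.comp_hasFDerivAt z (innerSL ℂ w).hasFDerivAt

lemma sum_eq_inner {d : ℕ} (z w : EuclideanSpace ℂ (Fin d)) :
    ∑ j, z j * star (w j) = inner ℂ w z := by
  rw [PiLp.inner_apply]
  exact Finset.sum_congr rfl fun j _ => by simp

/-- Coefficient of the Herglotz kernel. -/
noncomputable def kerCoeff {d : ℕ} (α : Fin d → ℕ) : ℂ :=
  if α = 0 then 1 / 2 else (Nat.multinomial Finset.univ α : ℂ)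

lemma kerCoeff_eq {d : ℕ} (α : Fin d → ℕ) :
    kerCoeff α = (Nat.multinomial Finset.univ α : ℂ) - if α = 0 then 1 / 2 else 0 := by
  unfold kerCoeff
  split_ifs with h
  · subst h; norm_num [Nat.multinomial]
  · simp

lemma kerCoeff_norm {d : ℕ} (α : Fin d → ℕ) :
    ‖kerCoeff α‖ ≤ (Nat.multinomial Finset.univ α : ℝ) := by
  unfold kerCoeff
  split_ifs with h
  · subst h; norm_num [Nat.multinomial]
  · simp

lemma hs_kernel {d : ℕ} (x : Fin d → ℂ) (h1 : ∑ j, ‖x j‖ < 1) :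
    HasSum (fun a : Fin d → ℕ => kerCoeff a * ∏ j, x j ^ a j)
      ((1 / 2) * ((1 + ∑ j, x j) / (1 - ∑ j, x j))) := by
  have hne : (1 : ℂ) - ∑ j, x j ≠ 0 := by
    intro h0
    have : ‖∑ j, x j‖ < 1 := (norm_sum_le _ _).trans_lt h1
    rw [← sub_eq_zero.1 h0, norm_one] at this
    exact lt_irrefl _ this
  have := (hs_multinomial x h1).sub (hasSum_ite_eq (0 : Fin d → ℕ) (1 / 2 : ℂ))
  have e1 : (fun a : Fin d → ℕ => kerCoeff a * ∏ j, x j ^ a j) = fun a =>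
      (Nat.multinomial Finset.univ a : ℂ) * ∏ j, x j ^ a j - if a = 0 then 1 / 2 else 0 := by
    funext a
    rw [kerCoeff_eq]
    by_cases ha : a = 0
    · subst ha; simp
    · simp [ha]
  have e2 : (1 / 2 : ℂ) * ((1 + ∑ j, x j) / (1 - ∑ j, x j)) = (1 - ∑ j, x j)⁻¹ - 1 / 2 := by
    generalize ∑ j, x j = y at hne
    field_simp
    ring
  rw [e1, e2]
  exact this

lemma meas_coord {d : ℕ} (j : Fin d) : Measurable fun w : EuclideanSpace ℂ (Fin d) => w j :=
  (by fun_prop : Continuous fun w : EuclideanSpace ℂ (Fin d) => w j).measurable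

lemma g_series (d : ℕ) (ν : Measure (EuclideanSpace ℂ (Fin d))) [IsFiniteMeasure ν]
    (h : EuclideanSpace ℂ (Fin d) → ℂ) (hmeas : Measurable h) (hbd : ∀ w, ‖h w‖ ≤ 1)
    (r : ℝ) (hr0 : 0 ≤ r) (hr : r < 1) (hae : ∀ᵐ w ∂ν, ‖w‖ ≤ r)
    (z : EuclideanSpace ℂ (Fin d)) (hz : ‖z‖ < 1) :
    HasSum (fun α : Fin d → ℕ =>
      (kerCoeff α * ∫ w, (∏ j, star (w j) ^ α j) * star (h w) ∂ν) * ∏ j, z j ^ α j)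
      ((1 / 2 : ℂ) * ∫ w, ((1 + ∑ j, z j * star (w j)) / (1 - ∑ j, z j * star (w j))) *
          star (h w) ∂ν) := by
  have hms : Measurable fun w => star (h w) := continuous_star.measurable.comp hmeas
  have hle : ∀ w : EuclideanSpace ℂ (Fin d), ‖w‖ ≤ r → ∑ j, ‖z j * star (w j)‖ ≤ r := by
    intro w hw
    refine (cs z w).trans ?_
    nlinarith [norm_nonneg z, norm_nonneg w]
  have key := interchange ν (fun (α : Fin d → ℕ) (w : EuclideanSpace ℂ (Fin d)) =>
      (kerCoeff α * ∏ j, (z j * star (w j)) ^ α j) * star (h w)) ?_ (1 - r)⁻¹ ?_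
  · convert key using 1
    · funext α
      rw [mul_right_comm, ← integral_const_mul]
      congr 1
      funext w
      simp only [mul_pow, Finset.prod_mul_distrib]
      ring
    · rw [← integral_const_mul]
      refine integral_congr_ae ?_
      filter_upwards [hae] with w hw
      have := (hs_kernel (fun j => z j * star (w j)) ((hle w hw).trans_lt hr)).mul_right (star (h w))
      rw [this.tsum_eq]
      ring
  · intro α
    refine (Measurable.const_mul ?_ _).mul hms
    refine Finset.measurable_prod _ fun j _ => ?_
    exact ((continuous_star.measurable.comp (meas_coord j)).const_mul _).pow_const _
  · filter_upwards [hae] with w hw T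
    have hy := hle w hw
    have hs := hs_multinomial (𝕜 := ℝ) (fun j => ‖z j * star (w j)‖)
      (by simpa only [norm_norm] using hy.trans_lt hr)
    have h2 : ∑ α ∈ T, ‖(kerCoeff α * ∏ j, (z j * star (w j)) ^ α j) * star (h w)‖ ≤
        (1 - ∑ j, ‖z j * star (w j)‖)⁻¹ := by
      refine le_trans (Finset.sum_le_sum fun α _ => ?_)
        (sum_le_hasSum T (fun α _ => ?_) hs)
      · rw [norm_mul, norm_mul, norm_star, norm_prod]
        simp only [norm_pow]
        have hp : 0 ≤ ∏ j, ‖z j * star (w j)‖ ^ α j :=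
          Finset.prod_nonneg fun j _ => pow_nonneg (norm_nonneg _) _
        calc _ ≤ ((Nat.multinomial Finset.univ α : ℝ) * ∏ j, ‖z j * star (w j)‖ ^ α j) * 1 :=
              mul_le_mul (mul_le_mul_of_nonneg_right (kerCoeff_norm α) hp) (hbd w)
                (norm_nonneg _) (by positivity)
          _ = _ := mul_one _
      · positivity
    refine h2.trans ?_
    gcongr

/-- Let `μ = h dν` be a finite complex Borel measure (here
`ν` is a finite positive measure, `h` a bounded measurable density) whose
support is contained in a closed ball of radius `s < 1` inside the open unit
ball `B^d`, and let `g z = (1/2) ∫ (1 + ⟨z,w⟩)/(1 - ⟨z,w⟩) d(conj μ)(w)`.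
Then `g` is holomorphic in a neighborhood of the closed unit ball, and for
every holomorphic `f` on `B^d` (with Taylor coefficients `c`, and `dc` the
Taylor coefficients of `g`) one has
`∫ f dμ = Q(f,g) = ∑_α c_α conj (dc_α) α!/|α|! + f 0 conj (g 0)`. -/
theorem pairing_represents_integral
    (d : ℕ) (ν : Measure (EuclideanSpace ℂ (Fin d))) [IsFiniteMeasure ν]
    (h : EuclideanSpace ℂ (Fin d) → ℂ) (hmeas : Measurable h)
    (hbd : ∀ w, ‖h w‖ ≤ 1)
    (s : ℝ) (hs : s < 1)
    (hsupp : ν (Metric.closedBall (0 : EuclideanSpace ℂ (Fin d)) s)ᶜ = 0)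
    (g : EuclideanSpace ℂ (Fin d) → ℂ)
    (hg : ∀ z : EuclideanSpace ℂ (Fin d),
      g z = (1 / 2 : ℂ) * ∫ w,
        ((1 + ∑ j, z j * star (w j)) / (1 - ∑ j, z j * star (w j))) *
          star (h w) ∂ν) :
    (∃ t : ℝ, 1 < t ∧
        DifferentiableOn ℂ g (Metric.ball (0 : EuclideanSpace ℂ (Fin d)) t)) ∧
      ∀ (f : EuclideanSpace ℂ (Fin d) → ℂ) (c dc : (Fin d → ℕ) → ℂ),
        (∀ z : EuclideanSpace ℂ (Fin d), ‖z‖ < 1 →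
          HasSum (fun α : Fin d → ℕ => c α * ∏ j, z j ^ α j) (f z)) →
        (∀ z : EuclideanSpace ℂ (Fin d), ‖z‖ < 1 →
          HasSum (fun α : Fin d → ℕ => dc α * ∏ j, z j ^ α j) (g z)) →
        (∫ w, f w * h w ∂ν) =
          (∑' α : Fin d → ℕ, c α * star (dc α) *
            (((∏ j, (α j)! : ℕ) : ℂ) / (((∑ j, α j)! : ℕ) : ℂ))) +
            f 0 * star (g 0) := by
  set r : ℝ := max s 0 with hrdef
  have hr0 : 0 ≤ r := le_max_right _ _
  have hr : r < 1 := max_lt hs one_pos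
  have hae : ∀ᵐ w ∂ν, ‖w‖ ≤ r := by
    have : ∀ᵐ w ∂ν, w ∈ Metric.closedBall (0 : EuclideanSpace ℂ (Fin d)) s := mem_ae_iff.2 hsupp
    exact this.mono fun w hw => (mem_closedBall_zero_iff.1 hw).trans (le_max_left _ _)
  refine ⟨?_, ?_⟩
  · obtain ⟨t, ht, hd⟩ := part_one d ν h hmeas hbd r hr0 hr hae
    refine ⟨t, ht, ?_⟩
    have : g = fun z => (1 / 2 : ℂ) *
        ∫ w, ((1 + inner ℂ w z) / (1 - inner ℂ w z)) * star (h w) ∂ν := by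
      funext z
      rw [hg z]
      simp only [sum_eq_inner]
    rw [this]
    exact hd.const_mul _
  · intro f c dc hf hgs
    have hdc : ∀ α, dc α = kerCoeff α * ∫ w, (∏ j, star (w j) ^ α j) * star (h w) ∂ν := by
      have h0 := coeff_unique (fun α => dc α -
        kerCoeff α * ∫ w, (∏ j, star (w j) ^ α j) * star (h w) ∂ν) ?_
      · intro α
        exact sub_eq_zero.1 (congrFun h0 α)
      · intro z hz
        have h1 := (hgs z hz).sub
          (hg z ▸ g_series d ν h hmeas hbd r hr0 hr hae z hz)
        rw [sub_self] at h1
        simpa only [sub_mul] using h1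
    have hstar : ∀ α, star (dc α) = kerCoeff α * ∫ w, (∏ j, w j ^ α j) * h w ∂ν := by
      intro α
      have hk : star (kerCoeff α) = kerCoeff α := by
        unfold kerCoeff
        split_ifs <;> simp
      rw [hdc α, star_mul', hk]
      congr 1
      have := integral_conj (μ := ν)
        (f := fun w : EuclideanSpace ℂ (Fin d) => (∏ j, star (w j) ^ α j) * star (h w))
      refine (this.symm : _).trans ?_
      congr 1
      funext w
      simp
    obtain ⟨C, hC⟩ := compact_bound c (fun z hz => (hf z hz).summable) r hr
    have hI : HasSum (fun α => c α * ∫ w, (∏ j, w j ^ α j) * h w ∂ν) (∫ w, f w * h w ∂ν) := by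
      have key := interchange ν (fun (α : Fin d → ℕ) (w : EuclideanSpace ℂ (Fin d)) =>
        (c α * ∏ j, w j ^ α j) * h w) ?_ C ?_
      · convert key using 1
        · funext α
          rw [← integral_const_mul]
          simp only [mul_assoc]
        · refine integral_congr_ae ?_
          filter_upwards [hae] with w hw
          exact ((hf w (hw.trans_lt hr)).mul_right (h w)).tsum_eq.symm
      · intro α
        refine (Measurable.const_mul ?_ _).mul hmeas
        exact Finset.measurable_prod _ fun j _ => (meas_coord j).pow_const _
      · filter_upwards [hae] with w hw T
        refine le_trans (Finset.sum_le_sum fun α _ => ?_) (hC w (mem_closedBall_zero_iff.2 hw) T)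
        rw [norm_mul]
        exact mul_le_of_le_one_right (norm_nonneg _) (hbd w)
    have hf0 : f 0 = c 0 := at_zero c _ (hf 0 (by simp))
    have hg0 : g 0 = dc 0 := at_zero dc _ (hgs 0 (by simp))
    have hfin := hI.sub (hasSum_ite_eq (0 : Fin d → ℕ)
      (c 0 * star (dc 0)))
    have hterm : (fun α : Fin d → ℕ => c α * star (dc α) *
            (((∏ j, (α j)! : ℕ) : ℂ) / (((∑ j, α j)! : ℕ) : ℂ))) =
        fun α => c α * (∫ w, (∏ j, w j ^ α j) * h w ∂ν) -
          if α = 0 then c 0 * star (dc 0) else 0 := by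
      funext α
      by_cases hα : α = 0
      · subst hα
        rw [hstar 0]
        simp [kerCoeff]
        ring
      · rw [if_neg hα, sub_zero, hstar α, kerCoeff, if_neg hα,
          ← Nat.multinomial_spec Finset.univ α]
        have h1 : ((∏ j, (α j)! : ℕ) : ℂ) ≠ 0 :=
          Nat.cast_ne_zero.2 (Finset.prod_ne_zero_iff.2 fun j _ => Nat.factorial_ne_zero _)
        have h2 : (Nat.multinomial Finset.univ α : ℂ) ≠ 0 :=
          Nat.cast_ne_zero.2 (Nat.multinomial_pos _ _).ne'
        rw [Nat.cast_mul]
        field_simp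
    rw [hterm, hfin.tsum_eq, hf0, hg0]
    ring
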